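/- arXiv:1404.6920 — 2 statements merged into one kernel-verified Lean document; each statement's English description precedes it below -/
import Mathlib

section
/- Let (x̃_k, d̃_k) ∈ A_k × D_k be a maximizing pair for m̃_k, for every k ≥ 1. Then (i) lim_{k→∞} | h_k(x̃_k, d̃_k) − h(x̃_k, d̃_k) | = 0; and (ii) if (m̃_{k_j})_{j≥1} is any convergent subsequence of (m̃_k), then lim_{j→∞} m̃_{k_j} = lim_{j→∞} h(x̃_{k_j}, d̃_{k_j}). -/
open Metric Set MeasureTheory Filter Topology
open scoped ENNReal NNReal

noncomputable section

/-- `P^s_δ(A)`: the supremum of `∑ᵢ |Bᵢ|^s` over all `δ`-packings of `A`, i.e. countable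
collections of pairwise disjoint closed balls centered at points of `A` with diameters `≤ δ`.
(Finite packings are represented by padding with empty balls of negative radius, which
contribute `0` to the sum.) -/
def packPre {X : Type*} [PseudoMetricSpace X] (s δ : ℝ) (A : Set X) : ℝ≥0∞ :=
  ⨆ (cen : ℕ → X) (rad : ℕ → ℝ) (_ : ∀ i, cen i ∈ A)
    (_ : ∀ i, Metric.diam (Metric.closedBall (cen i) (rad i)) ≤ δ)
    (_ : Pairwise fun i j =>
      Disjoint (Metric.closedBall (cen i) (rad i)) (Metric.closedBall (cen j) (rad j))),
    ∑' i, ENNReal.ofReal (Metric.diam (Metric.closedBall (cen i) (rad i)) ^ s)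

/-- The packing premeasure `P₀^s(A) = lim_{δ→0} P^s_δ(A)`; since `δ ↦ P^s_δ(A)` is
nondecreasing, the limit is the infimum over `δ > 0`. -/
def packPre0 {X : Type*} [PseudoMetricSpace X] (s : ℝ) (A : Set X) : ℝ≥0∞ :=
  ⨅ (δ : ℝ) (_ : 0 < δ), packPre s δ A

/-- The packing measure `P^s(A) = inf { ∑ᵢ P₀^s(Uᵢ) : A ⊆ ⋃ᵢ Uᵢ }`. -/
def packM {X : Type*} [PseudoMetricSpace X] (s : ℝ) (A : Set X) : ℝ≥0∞ :=
  ⨅ (U : ℕ → Set X) (_ : A ⊆ ⋃ i, U i), ∑' i, packPre0 s (U i)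

/-- The density function `h(x,d) = (2d)^s / μ(B(x,d))` (closed ball). -/
def densityh {X : Type*} [PseudoMetricSpace X] [MeasurableSpace X]
    (μ : MeasureTheory.Measure X) (s : ℝ) (x : X) (d : ℝ) : ℝ≥0∞ :=
  ENNReal.ofReal ((2 * d) ^ s) / μ (Metric.closedBall x d)

/-- The discrete density function `h_k(x,d) = (2d)^s / μ_k(B'(x,d))` (open ball). -/
def densityhk {X : Type*} [PseudoMetricSpace X] [MeasurableSpace X]
    (μ : MeasureTheory.Measure X) (s : ℝ) (x : X) (d : ℝ) : ℝ≥0∞ :=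
  ENNReal.ofReal ((2 * d) ^ s) / μ (Metric.ball x d)

/-- `fWord f σ k = f_{σ 0} ∘ ⋯ ∘ f_{σ (k-1)}`: the composition of the maps along the
first `k` letters of the code `σ` (so `fWord f σ k '' E` is the cylinder set `E_{σ(k)}`). -/
def fWord {X : Type*} {N : ℕ} (f : Fin N → X → X) (σ : ℕ → Fin N) : ℕ → X → X
  | 0 => id
  | (k+1) => fWord f σ k ∘ f (σ k)

/-- `rWord rr σ k = r_{σ 0} ⋯ r_{σ (k-1)}`: the contraction ratio of `fWord f σ k`. -/
def rWord {N : ℕ} (rr : Fin N → ℝ) (σ : ℕ → Fin N) (k : ℕ) : ℝ :=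
  ∏ j ∈ Finset.range k, rr (σ j)

/-- The algorithm's point sets: `algA f 1` is the set of fixed points of the maps `fᵢ`,
and `algA f (k+1) = ⋃ i, fᵢ(algA f k)`; `algA f 0` is unused (empty). -/
def algA {X : Type*} {N : ℕ} (f : Fin N → X → X) : ℕ → Set X
  | 0 => ∅
  | 1 => {x | ∃ i, f i x = x}
  | (k+2) => ⋃ i, f i '' algA f (k+1)

/-- Composition of the maps `fᵢ` along a finite word `w`. -/
def wordComp {X : Type*} {N : ℕ} (f : Fin N → X → X) : ∀ k, (Fin k → Fin N) → X → X
  | 0, _ => id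
  | (k+1), w => f (w 0) ∘ wordComp f k (w ∘ Fin.succ)

/-- The discrete measures `μ_k = ∑_{x ∈ A_k} r_{i_k(x)}^s · δ_x`: the sum runs over all
words `w` of length `k`, with weight `r_w^s` and Dirac mass at the point of `A_k` with
address `w`, namely `f_w(fix(last letter of w))`; `algMu … 0` is unused (zero measure). -/
def algMu {X : Type*} [MeasurableSpace X] {N : ℕ} (f : Fin N → X → X)
    (rr : Fin N → ℝ) (fix : Fin N → X) (s : ℝ) : ℕ → MeasureTheory.Measure X
  | 0 => 0
  | (k+1) => ∑ w : Fin (k+1) → Fin N,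
      ENNReal.ofReal ((∏ j, rr (w j)) ^ s) •
        MeasureTheory.Measure.dirac (wordComp f (k+1) w (fix (w (Fin.last k))))

/-- The algorithm's admissible set of radii
`D_k = {dist(x,y) : x, y ∈ A_k} ∩ [c̃, c̃/r_min]`. -/
def algD {X : Type*} [PseudoMetricSpace X] {N : ℕ} (f : Fin N → X → X)
    (ct rmin : ℝ) (k : ℕ) : Set ℝ :=
  {d | (∃ x ∈ algA f k, ∃ y ∈ algA f k, d = dist x y) ∧ ct ≤ d ∧ d ≤ ct / rmin}

end


section SphereNull

variable {n : ℕ}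

/-- Sets which are nonempty intersections of spheres. -/
def SphInt (T : Set (EuclideanSpace ℝ (Fin n))) : Prop :=
  ∃ C : Set (EuclideanSpace ℝ (Fin n) × ℝ), C.Nonempty ∧ (∀ p ∈ C, 0 ≤ p.2) ∧
    T = ⋂ p ∈ C, sphere p.1 p.2

theorem SphInt.inter {T T' : Set (EuclideanSpace ℝ (Fin n))} (h : SphInt T) (h' : SphInt T') :
    SphInt (T ∩ T') := by
  obtain ⟨C, hC, hC0, rfl⟩ := h
  obtain ⟨C', hC', hC0', rfl⟩ := h'
  refine ⟨C ∪ C', hC.inl, ?_, ?_⟩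
  · rintro p (hp | hp)
    · exact hC0 p hp
    · exact hC0' p hp
  · rw [biInter_union]

theorem SphInt.isClosed {T : Set (EuclideanSpace ℝ (Fin n))} (h : SphInt T) : IsClosed T := by
  obtain ⟨C, hC, hC0, rfl⟩ := h
  exact isClosed_biInter fun p _ => isClosed_sphere

theorem SphInt.isBounded {T : Set (EuclideanSpace ℝ (Fin n))} (h : SphInt T) :
    Bornology.IsBounded T := by
  obtain ⟨C, ⟨p, hp⟩, hC0, rfl⟩ := h
  exact isBounded_sphere.subset (biInter_subset_of_mem hp)

theorem SphInt.preimage {T : Set (EuclideanSpace ℝ (Fin n))} (h : SphInt T)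
    (e : EuclideanSpace ℝ (Fin n) ≃ EuclideanSpace ℝ (Fin n)) (r : ℝ) (hr : 0 < r)
    (he : ∀ x y, dist (e x) (e y) = r * dist x y) : SphInt (e ⁻¹' T) := by
  obtain ⟨C, hC, hC0, rfl⟩ := h
  refine ⟨(fun p => (e.symm p.1, p.2 / r)) '' C, hC.image _, ?_, ?_⟩
  · rintro _ ⟨p, hp, rfl⟩
    have := hC0 p hp
    positivity
  · ext y
    simp only [mem_preimage, mem_iInter, mem_sphere, mem_image, forall_exists_index, and_imp,
      forall_apply_eq_imp_iff₂]
    refine forall₂_congr fun p hp => ?_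
    rw [eq_div_iff hr.ne', mul_comm, ← he]
    simp

/-- The quadratic embedding linearizing spheres. -/
noncomputable def sphPhi (y : EuclideanSpace ℝ (Fin n)) : ℝ × EuclideanSpace ℝ (Fin n) × ℝ := (‖y‖ ^ 2, y, 1)

noncomputable def sphL (x : EuclideanSpace ℝ (Fin n)) (R : ℝ) :
    (ℝ × EuclideanSpace ℝ (Fin n) × ℝ) →ₗ[ℝ] ℝ where
  toFun q := q.1 - 2 * inner ℝ q.2.1 x + q.2.2 * (‖x‖ ^ 2 - R ^ 2)
  map_add' a b := by simp [inner_add_left]; ring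
  map_smul' a b := by simp [inner_smul_left]; ring

theorem mem_sphere_iff_sphL (x y : EuclideanSpace ℝ (Fin n)) (R : ℝ) (hR : 0 ≤ R) :
    y ∈ sphere x R ↔ sphL x R (sphPhi y) = 0 := by
  rw [mem_sphere, dist_eq_norm, ← sq_eq_sq₀ (norm_nonneg _) hR, norm_sub_sq_real]
  simp only [sphL, sphPhi, LinearMap.coe_mk, AddHom.coe_mk]
  constructor <;> intro h <;> linarith

theorem SphInt.finrank_lt {T T' : Set (EuclideanSpace ℝ (Fin n))} (h : SphInt T) (hs : T ⊂ T') :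
    Module.finrank ℝ (Submodule.span ℝ (sphPhi '' T)) <
      Module.finrank ℝ (Submodule.span ℝ (sphPhi '' T')) := by
  apply Submodule.finrank_lt_finrank_of_lt
  refine lt_of_le_of_ne (Submodule.span_mono (image_mono hs.1)) ?_
  intro heq
  apply hs.2
  intro y hy
  have hy' : sphPhi y ∈ Submodule.span ℝ (sphPhi '' T) := by
    rw [heq]; exact Submodule.subset_span (mem_image_of_mem _ hy)
  obtain ⟨C, hC, hC0, rfl⟩ := h
  simp only [mem_iInter]
  intro p hp
  rw [mem_sphere_iff_sphL _ _ _ (hC0 p hp)]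
  have : Submodule.span ℝ (sphPhi '' (⋂ p ∈ C, sphere p.1 p.2)) ≤
      LinearMap.ker (sphL p.1 p.2) := by
    rw [Submodule.span_le]
    rintro _ ⟨z, hz, rfl⟩
    simp only [mem_iInter] at hz
    exact (mem_sphere_iff_sphL _ _ _ (hC0 p hp)).1 (hz p hp)
  exact this hy'

/-- A self-similar atomless probability measure does not charge spheres. -/
theorem sphere_null_aux {N : ℕ} (hN : 0 < N)
    (e : Fin N → EuclideanSpace ℝ (Fin n) ≃ EuclideanSpace ℝ (Fin n))
    (rr : Fin N → ℝ) (hr : ∀ i, 0 < rr i ∧ rr i < 1)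
    (hsim : ∀ i x y, dist (e i x) (e i y) = rr i * dist x y)
    (p : Fin N → ℝ) (hp : ∀ i, 0 < p i) (hp1 : ∑ i, p i = 1)
    (μ : Measure (EuclideanSpace ℝ (Fin n))) [IsProbabilityMeasure μ] [NullSingletonClass μ]
    (hμ : ∀ A : Set (EuclideanSpace ℝ (Fin n)), MeasurableSet A →
      μ.real A = ∑ i, p i * μ.real (e i ⁻¹' A))
    (x : EuclideanSpace ℝ (Fin n)) (d : ℝ) : μ (sphere x d) = 0 := by
  by_contra hne
  have hd : 0 ≤ d := by
    by_contra h
    apply hne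
    rw [sphere_eq_empty_of_neg (not_le.1 h)]; simp
  have hsymm : ∀ i x y, dist ((e i).symm x) ((e i).symm y) = (rr i)⁻¹ * dist x y := by
    intro i x y
    have := hsim i ((e i).symm x) ((e i).symm y)
    simp only [Equiv.apply_symm_apply] at this
    rw [this, inv_mul_cancel_left₀ (hr i).1.ne']
  -- minimal elements
  let M : Set (Set (EuclideanSpace ℝ (Fin n))) :=
    {T | SphInt T ∧ 0 < μ.real T ∧ ∀ T', SphInt T' → T' ⊂ T → μ.real T' = 0}
  have hMne : M.Nonempty := by
    let P : Set (Set (EuclideanSpace ℝ (Fin n))) := {T | SphInt T ∧ 0 < μ.real T}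
    have hP : P.Nonempty := ⟨sphere x d, ⟨{(x, d)}, by simp, by simpa using hd, by simp⟩,
      ENNReal.toReal_pos hne (measure_ne_top _ _)⟩
    let rk : Set (EuclideanSpace ℝ (Fin n)) → ℕ :=
      fun T => Module.finrank ℝ (Submodule.span ℝ (sphPhi '' T))
    obtain ⟨T, hT, hmin⟩ := exists_minimalFor_of_wellFoundedLT (· ∈ P) rk hP
    refine ⟨T, hT.1, hT.2, fun T' h' hss => ?_⟩
    by_contra h0
    have h1 : T' ∈ P := ⟨h', lt_of_le_of_ne measureReal_nonneg (Ne.symm h0)⟩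
    have h2 := h'.finrank_lt hss
    have h3 := hmin h1 h2.le
    exact absurd h2 (not_lt.2 h3)
  have hdisj : ∀ T ∈ M, ∀ T' ∈ M, T ≠ T' → μ.real (T ∩ T') = 0 := by
    intro T hT T' hT' hne'
    by_cases h : T ∩ T' = T
    · have h1 : T ⊂ T' := ssubset_of_subset_of_ne (inter_eq_left.1 h) hne'
      have := hT'.2.2 T hT.1 h1
      exact absurd this hT.2.1.ne'
    · exact hT.2.2 _ (hT.1.inter hT'.1) (ssubset_of_subset_of_ne inter_subset_left h)
  have hfin : ∀ ε : ℝ, 0 < ε → {T ∈ M | ε ≤ μ.real T}.Finite := by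
    intro ε hε
    have := Measure.finite_const_le_meas_of_disjoint_iUnion₀ μ (ε := ENNReal.ofReal ε)
      (by simpa using hε) (As := fun T : M => (T : Set (EuclideanSpace ℝ (Fin n))))
      (fun T => T.2.1.isClosed.measurableSet.nullMeasurableSet)
      (fun T T' h => by
        have := hdisj T T.2 T' T'.2 (fun h' => h (Subtype.ext h'))
        exact (measureReal_eq_zero_iff (measure_ne_top _ _)).1 this) (measure_ne_top _ _)
    refine (this.image (fun T : M => (T : Set (EuclideanSpace ℝ (Fin n))))).subset ?_
    rintro T ⟨hT, hle⟩
    refine ⟨⟨T, hT⟩, ?_, rfl⟩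
    exact (ENNReal.ofReal_le_iff_le_toReal (measure_ne_top _ _)).2 hle
  obtain ⟨T₀, hT₀⟩ := hMne
  -- maximal mass
  obtain ⟨T₁, hT₁, hmax⟩ := exists_max_image _ (fun T => μ.real T) (hfin _ hT₀.2.1)
    ⟨T₀, hT₀, le_rfl⟩
  have hmax' : ∀ T ∈ M, μ.real T ≤ μ.real T₁ := by
    intro T hT
    by_cases h : μ.real T₀ ≤ μ.real T
    · exact hmax T ⟨hT, h⟩
    · exact (not_le.1 h).le.trans hT₁.2
  obtain ⟨T₂, hT₂, hmaxd⟩ := exists_max_image _ (fun T => diam T) (hfin _ hT₁.1.2.1)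
    ⟨T₁, hT₁.1, le_rfl⟩
  have hpre : ∀ T ∈ M, ∀ i, μ.real (e i ⁻¹' T) = 0 ∨ e i ⁻¹' T ∈ M := by
    intro T hT i
    by_cases h0 : μ.real (e i ⁻¹' T) = 0
    · exact Or.inl h0
    refine Or.inr ⟨hT.1.preimage _ _ (hr i).1 (hsim i),
      lt_of_le_of_ne measureReal_nonneg (Ne.symm h0), ?_⟩
    intro T' hT' hss
    have h1 : SphInt ((e i).symm ⁻¹' T') :=
      hT'.preimage _ _ (inv_pos.2 (hr i).1) (hsymm i)
    have h2 : (e i).symm ⁻¹' T' ⊂ T := by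
      rw [← (e i).image_eq_preimage_symm]
      refine ⟨by simpa using hss.1, fun h => hss.2 ?_⟩
      intro y hy
      obtain ⟨z, hz, hzy⟩ := h hy
      rwa [← (e i).injective hzy]
    have h3 := hT.2.2 _ h1 h2
    rw [hμ _ h1.isClosed.measurableSet] at h3
    have h4 := (Finset.sum_eq_zero_iff_of_nonneg
      (fun j _ => mul_nonneg (hp j).le measureReal_nonneg)).1 h3 i (Finset.mem_univ _)
    have h5 := (mul_eq_zero.1 h4).resolve_left (hp i).ne'
    rwa [← preimage_comp, Equiv.symm_comp_self, preimage_id] at h5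
  have hT₂eq : μ.real T₂ = μ.real T₁ := le_antisymm (hmax' _ hT₂.1) hT₂.2
  have hle : ∀ i, μ.real (e i ⁻¹' T₂) ≤ μ.real T₁ := by
    intro i
    rcases hpre T₂ hT₂.1 i with h | h
    · rw [h]; exact measureReal_nonneg
    · exact hmax' _ h
  have heq : ∀ i, μ.real (e i ⁻¹' T₂) = μ.real T₁ := by
    have h1 := hμ T₂ hT₂.1.1.isClosed.measurableSet
    have h2 : ∑ i, p i * μ.real (e i ⁻¹' T₂) = ∑ i, p i * μ.real T₁ := by
      rw [← h1, ← Finset.sum_mul, hp1, one_mul, hT₂eq]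
    intro i
    have := (Finset.sum_eq_sum_iff_of_le
      (fun j _ => mul_le_mul_of_nonneg_left (hle j) (hp j).le)).1 h2 i (Finset.mem_univ _)
    exact mul_left_cancel₀ (hp i).ne' this
  let i : Fin N := ⟨0, hN⟩
  have hiM : e i ⁻¹' T₂ ∈ M := by
    rcases hpre T₂ hT₂.1 i with h | h
    · rw [heq] at h; exact absurd h hT₁.1.2.1.ne'
    · exact h
  have hdle := hmaxd _ ⟨hiM, (heq i).ge⟩
  have hbd : Bornology.IsBounded (e i ⁻¹' T₂) := hiM.1.isBounded
  have hnt : T₂.Nontrivial := by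
    rw [← not_subsingleton_iff]
    intro h
    have := hT₂.1.2.1
    rw [measureReal_def, h.measure_zero] at this
    simp at this
  have hdpos : 0 < diam T₂ := diam_pos hnt hT₂.1.1.isBounded
  have : diam T₂ ≤ rr i * diam (e i ⁻¹' T₂) := by
    refine diam_le_of_forall_dist_le (mul_nonneg (hr i).1.le diam_nonneg) ?_
    intro y hy z hz
    have := hsim i ((e i).symm y) ((e i).symm z)
    simp only [Equiv.apply_symm_apply] at this
    rw [this]
    refine mul_le_mul_of_nonneg_left (dist_le_diam_of_mem hbd ?_ ?_) (hr i).1.le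
    · simpa using hy
    · simpa using hz
  have h1 := (hr i).2
  have h2 := (hr i).1
  nlinarith [mul_le_mul_of_nonneg_left hdle h2.le]

/-- A similitude of Euclidean space is surjective. -/
theorem sim_surjective (f : EuclideanSpace ℝ (Fin n) → EuclideanSpace ℝ (Fin n)) (r : ℝ)
    (hr : 0 < r) (hf : ∀ x y, dist (f x) (f y) = r * dist x y) : Function.Surjective f := by
  have hi : Isometry (fun x => r⁻¹ • f x) := by
    refine Isometry.of_dist_eq fun x y => ?_
    rw [dist_smul₀, hf, Real.norm_of_nonneg (inv_pos.2 hr).le, inv_mul_cancel_left₀ hr.ne']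
  intro y
  obtain ⟨x, hx⟩ := (hi.affineIsometryOfStrictConvexSpace.toAffineIsometryEquiv rfl).surjective
    (r⁻¹ • y)
  refine ⟨x, ?_⟩
  simp only [AffineIsometry.coe_toAffineIsometryEquiv,
    Isometry.coe_affineIsometryOfStrictConvexSpace] at hx
  exact smul_right_injective _ (inv_pos.2 hr).ne' hx

end SphereNull

section SelfSimilar

variable {n N : ℕ}

theorem algMu_one_apply (f : Fin N → EuclideanSpace ℝ (Fin n) → EuclideanSpace ℝ (Fin n))
    (rr : Fin N → ℝ) (fix : Fin N → EuclideanSpace ℝ (Fin n)) (hfix : ∀ i, f i (fix i) = fix i)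
    (s : ℝ) (A : Set (EuclideanSpace ℝ (Fin n))) (hA : MeasurableSet A) :
    algMu f rr fix s 1 A = ∑ i, ENNReal.ofReal (rr i ^ s) * A.indicator 1 (fix i) := by
  simp only [algMu, Measure.finsetSum_apply, Measure.smul_apply, smul_eq_mul]
  rw [← (Equiv.funUnique (Fin 1) (Fin N)).symm.sum_comp]
  refine Finset.sum_congr rfl fun i _ => ?_
  simp [wordComp, hfix, Measure.dirac_apply' _ hA]

theorem algMu_succ_apply (f : Fin N → EuclideanSpace ℝ (Fin n) → EuclideanSpace ℝ (Fin n))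
    (hfm : ∀ i, Measurable (f i))
    (rr : Fin N → ℝ) (hr : ∀ i, 0 < rr i) (fix : Fin N → EuclideanSpace ℝ (Fin n))
    (s : ℝ) (k : ℕ) (A : Set (EuclideanSpace ℝ (Fin n))) (hA : MeasurableSet A) :
    algMu f rr fix s (k + 2) A =
      ∑ i, ENNReal.ofReal (rr i ^ s) * algMu f rr fix s (k + 1) (f i ⁻¹' A) := by
  simp only [algMu, Measure.finsetSum_apply, Measure.smul_apply, smul_eq_mul]
  rw [← (Fin.consEquiv (fun _ => Fin N)).sum_comp, Fintype.sum_prod_type]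
  refine Finset.sum_congr rfl fun i _ => ?_
  rw [Finset.mul_sum]
  refine Finset.sum_congr rfl fun w _ => ?_
  rw [Measure.dirac_apply' _ hA, Measure.dirac_apply' _ (hfm i hA)]
  rw [← mul_assoc, ← ENNReal.ofReal_mul (Real.rpow_nonneg (hr i).le _),
    ← Real.mul_rpow (hr i).le (Finset.prod_nonneg fun j _ => (hr _).le)]
  have h1 : ∏ j, rr ((Fin.consEquiv (fun _ => Fin N)) (i, w) j) = rr i * ∏ j, rr (w j) := by
    rw [Fin.prod_univ_succ]; simp [Fin.consEquiv]
  rw [h1]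
  congr 1

/-- The measure is carried by `E`. -/
theorem measure_compl_zero (hN : 0 < N)
    (f : Fin N → EuclideanSpace ℝ (Fin n) → EuclideanSpace ℝ (Fin n))
    (rr : Fin N → ℝ) (ρ : ℝ) (hρ1 : ρ < 1) (hρ : ∀ i, rr i ≤ ρ) (hr : ∀ i, 0 < rr i)
    (hsim : ∀ i x y, dist (f i x) (f i y) = rr i * dist x y)
    (E : Set (EuclideanSpace ℝ (Fin n))) (hEne : E.Nonempty) (hEcp : IsCompact E)
    (hfE : ∀ i, ∀ x ∈ E, f i x ∈ E)
    (p : Fin N → ℝ) (hp : ∀ i, 0 < p i) (hp1 : ∑ i, p i = 1)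
    (μ : Measure (EuclideanSpace ℝ (Fin n))) [IsProbabilityMeasure μ]
    (hμ : ∀ A : Set (EuclideanSpace ℝ (Fin n)), MeasurableSet A →
      μ.real A = ∑ i, p i * μ.real (f i ⁻¹' A)) : μ Eᶜ = 0 := by
  have hρ0 : 0 < ρ := (hr ⟨0, hN⟩).trans_le (hρ _)
  have hinf : ∀ i x, infDist (f i x) E ≤ rr i * infDist x E := by
    intro i x
    obtain ⟨y, hy, hxy⟩ := hEcp.exists_infDist_eq_dist hEne x
    rw [hxy, ← hsim]
    exact infDist_le_dist_of_mem (hfE i y hy)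
  let G : ℝ → Set (EuclideanSpace ℝ (Fin n)) := fun t => {x | t < infDist x E}
  have hGm : ∀ t, MeasurableSet (G t) := fun t =>
    (isOpen_lt continuous_const (continuous_infDist_pt E)).measurableSet
  have hstep : ∀ t, 0 ≤ t → μ.real (G t) ≤ μ.real (G (t / ρ)) := by
    intro t ht
    rw [hμ _ (hGm t)]
    calc ∑ i, p i * μ.real (f i ⁻¹' G t) ≤ ∑ i, p i * μ.real (G (t / ρ)) := by
          refine Finset.sum_le_sum fun i _ => mul_le_mul_of_nonneg_left
            (measureReal_mono ?_) (hp i).le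
          intro x hx
          have h1 : t < infDist (f i x) E := hx
          have h2 := hinf i x
          show t / ρ < infDist x E
          rw [div_lt_iff₀ hρ0]
          nlinarith [hρ i, infDist_nonneg (x := x) (s := E)]
      _ = μ.real (G (t / ρ)) := by rw [← Finset.sum_mul, hp1, one_mul]
  have hiter : ∀ t, 0 ≤ t → ∀ k : ℕ, μ.real (G t) ≤ μ.real (G (t / ρ ^ k)) := by
    intro t ht k
    induction k with
    | zero => simp
    | succ k ih =>
      refine ih.trans ((hstep _ (by positivity)).trans_eq ?_)
      rw [div_div, pow_succ]
  have hzero : ∀ t, 0 < t → μ (G t) = 0 := by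
    intro t ht
    have hlim : Tendsto (fun k : ℕ => μ (G (t / ρ ^ k))) atTop (𝓝 (μ ∅)) := by
      refine tendsto_measure_of_ae_tendsto_indicator_of_isFiniteMeasure _ MeasurableSet.empty
        (fun k => hGm _) (Eventually.of_forall fun x => ?_)
      have h1 : Tendsto (fun k : ℕ => t / ρ ^ k) atTop atTop := by
        simp only [div_eq_mul_inv, ← inv_pow]
        exact (tendsto_pow_atTop_atTop_of_one_lt ((one_lt_inv₀ hρ0).2 hρ1)).const_mul_atTop ht
      filter_upwards [h1.eventually_ge_atTop (infDist x E)] with k hk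
      simpa [G] using hk
    rw [measure_empty] at hlim
    have := ge_of_tendsto' hlim (fun k => (ENNReal.toReal_le_toReal (measure_ne_top _ _) (measure_ne_top _ _)).1 (hiter t ht.le k))
    exact le_antisymm this zero_le
  have : Eᶜ ⊆ ⋃ k : ℕ, G (1 / ((k : ℝ) + 1)) := by
    intro x hx
    have h1 : 0 < infDist x E := (hEcp.isClosed.notMem_iff_infDist_pos hEne).1 hx
    obtain ⟨k, hk⟩ := exists_nat_one_div_lt h1
    exact mem_iUnion.2 ⟨k, hk⟩
  exact measure_mono_null this (measure_iUnion_null fun k => hzero _ (by positivity))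

theorem noAtoms_aux
    (f : Fin N → EuclideanSpace ℝ (Fin n) → EuclideanSpace ℝ (Fin n))
    (hinj : ∀ i, Function.Injective (f i))
    (E : Set (EuclideanSpace ℝ (Fin n)))
    (hEinv : E = ⋃ i, f i '' E)
    (hssc : ∀ i j, i ≠ j → Disjoint (f i '' E) (f j '' E))
    (p : Fin N → ℝ) (hp : ∀ i, 0 < p i) (q : ℝ) (hq : ∀ i, p i ≤ q) (hq1 : q < 1)
    (hq0 : 0 < q)
    (μ : Measure (EuclideanSpace ℝ (Fin n))) [IsProbabilityMeasure μ]
    (hμ : ∀ A : Set (EuclideanSpace ℝ (Fin n)), MeasurableSet A →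
      μ.real A = ∑ i, p i * μ.real (f i ⁻¹' A)) (hE : μ Eᶜ = 0) : NullSingletonClass μ := by
  have key : ∀ k : ℕ, ∀ x, μ.real {x} ≤ q ^ k := by
    intro k
    induction k with
    | zero => intro x; simpa using measureReal_le_one
    | succ k ih =>
      intro x
      by_cases hx : x ∈ E
      · have hx' := hx
        rw [hEinv] at hx'
        obtain ⟨j, y, hy, rfl⟩ := mem_iUnion.1 hx'
        rw [hμ _ (measurableSet_singleton _), Finset.sum_eq_single j]
        · have : f j ⁻¹' {f j y} = {y} := by
            ext z; simp [(hinj j).eq_iff]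
          rw [this, pow_succ, mul_comm]
          exact mul_le_mul (ih y) (hq j) (hp j).le (by positivity)
        · intro i _ hij
          have : f i ⁻¹' {f j y} ⊆ Eᶜ := by
            intro z hz hzE
            exact disjoint_left.1 (hssc i j hij) (mem_image_of_mem _ hzE)
              (by rw [mem_singleton_iff.1 hz]; exact mem_image_of_mem _ hy)
          rw [measureReal_def, measure_mono_null this hE]; simp
        · simp
      · have : ({x} : Set (EuclideanSpace ℝ (Fin n))) ⊆ Eᶜ := by simpa using hx
        rw [measureReal_def, measure_mono_null this hE]; simp; positivity
  refine ⟨fun x => ?_⟩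
  have h1 : μ.real {x} ≤ 0 :=
    ge_of_tendsto' (tendsto_pow_atTop_nhds_zero_of_lt_one hq0.le hq1) (fun k => key k x)
  exact (measureReal_eq_zero_iff (measure_ne_top _ _)).1 (le_antisymm h1 measureReal_nonneg)

theorem ball_pos_aux (hN : 0 < N)
    (f : Fin N → EuclideanSpace ℝ (Fin n) → EuclideanSpace ℝ (Fin n))
    (rr : Fin N → ℝ) (ρ : ℝ) (hρ1 : ρ < 1) (hρ : ∀ i, rr i ≤ ρ) (hr : ∀ i, 0 < rr i)
    (hsim : ∀ i x y, dist (f i x) (f i y) = rr i * dist x y)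
    (E : Set (EuclideanSpace ℝ (Fin n)))
    (hEinv : E = ⋃ i, f i '' E) (hEd : ∀ x ∈ E, ∀ y ∈ E, dist x y ≤ 1)
    (p : Fin N → ℝ) (hp : ∀ i, 0 < p i)
    (μ : Measure (EuclideanSpace ℝ (Fin n))) [IsProbabilityMeasure μ]
    (hμ : ∀ A : Set (EuclideanSpace ℝ (Fin n)), MeasurableSet A →
      μ.real A = ∑ i, p i * μ.real (f i ⁻¹' A)) (hE : μ Eᶜ = 0)
    (x : EuclideanSpace ℝ (Fin n)) (hx : x ∈ E) (d : ℝ) (hd : 0 < d) :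
    0 < μ (closedBall x d) := by
  have hρ0 : 0 < ρ := (hr ⟨0, hN⟩).trans_le (hρ _)
  have key : ∀ k : ℕ, ∀ x ∈ E, ∀ d, ρ ^ k ≤ d → 0 < μ.real (closedBall x d) := by
    intro k
    induction k with
    | zero =>
      intro x hx d hd
      have h1 : E ⊆ closedBall x d := fun y hy =>
        mem_closedBall.2 ((hEd y hy x hx).trans (by simpa using hd))
      have h2 : μ (closedBall x d)ᶜ = 0 := measure_mono_null (compl_subset_compl.2 h1) hE
      rw [prob_compl_eq_zero_iff measurableSet_closedBall] at h2
      simp [measureReal_def, h2]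
    | succ k ih =>
      intro x hx d hd
      rw [hEinv] at hx
      obtain ⟨j, y, hy, rfl⟩ := mem_iUnion.1 hx
      rw [hμ _ measurableSet_closedBall]
      refine Finset.sum_pos' (fun i _ => mul_nonneg (hp i).le measureReal_nonneg)
        ⟨j, Finset.mem_univ _, mul_pos (hp j) ?_⟩
      refine (ih y hy (ρ ^ k) le_rfl).trans_le (measureReal_mono ?_)
      intro z hz
      rw [mem_closedBall] at hz
      rw [mem_preimage, mem_closedBall, hsim]
      refine le_trans ?_ hd
      rw [pow_succ, mul_comm]
      exact mul_le_mul hz (hρ j) (hr j).le (by positivity)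
  obtain ⟨k, hk⟩ := exists_pow_lt_of_lt_one hd hρ1
  exact (ENNReal.toReal_pos_iff.1 (key k x hx d hk.le)).1

theorem fixed_mem (f : EuclideanSpace ℝ (Fin n) → EuclideanSpace ℝ (Fin n)) (r : ℝ) (hr1 : r < 1)
    (hsim : ∀ x y, dist (f x) (f y) = r * dist x y)
    (E : Set (EuclideanSpace ℝ (Fin n))) (hEne : E.Nonempty) (hEcp : IsCompact E)
    (hfE : ∀ x ∈ E, f x ∈ E) (x : EuclideanSpace ℝ (Fin n)) (hx : f x = x) : x ∈ E := by
  obtain ⟨y, hy, hxy⟩ := hEcp.exists_infDist_eq_dist hEne x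
  have h1 : infDist x E ≤ r * infDist x E := by
    calc infDist x E = infDist (f x) E := by rw [hx]
      _ ≤ dist (f x) (f y) := infDist_le_dist_of_mem (hfE y hy)
      _ = r * infDist x E := by rw [hsim, hxy]
  have h2 : infDist x E = 0 := by nlinarith [infDist_nonneg (x := x) (s := E)]
  exact (hEcp.isClosed.mem_iff_infDist_zero hEne).2 h2

theorem algA_subset (f : Fin N → EuclideanSpace ℝ (Fin n) → EuclideanSpace ℝ (Fin n))
    (E : Set (EuclideanSpace ℝ (Fin n))) (hfE : ∀ i, ∀ x ∈ E, f i x ∈ E)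
    (hfx : ∀ i x, f i x = x → x ∈ E) : ∀ k, algA f k ⊆ E
  | 0 => by simp [algA]
  | 1 => by
    rintro x ⟨i, hi⟩
    exact hfx i x hi
  | (k+2) => by
    intro x hx
    simp only [algA, mem_iUnion] at hx
    obtain ⟨i, y, hy, rfl⟩ := hx
    exact hfE i y (algA_subset f E hfE hfx (k+1) hy)

/-- Comparison of the discrete measures with the self-similar measure on balls. -/
theorem algMu_compare
    (f : Fin N → EuclideanSpace ℝ (Fin n) → EuclideanSpace ℝ (Fin n))
    (hsurj : ∀ i, Function.Surjective (f i))
    (rr : Fin N → ℝ) (ρ : ℝ) (hρ0 : 0 < ρ) (hρ : ∀ i, rr i ≤ ρ)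
    (hr : ∀ i, 0 < rr i ∧ rr i < 1)
    (hsim : ∀ i x y, dist (f i x) (f i y) = rr i * dist x y)
    (E : Set (EuclideanSpace ℝ (Fin n)))
    (hEd : ∀ x ∈ E, ∀ y ∈ E, dist x y ≤ 1) (s : ℝ)
    (μ : Measure (EuclideanSpace ℝ (Fin n))) [IsProbabilityMeasure μ]
    (hμss : ∀ A : Set (EuclideanSpace ℝ (Fin n)), MeasurableSet A →
      μ A = ∑ i, ENNReal.ofReal (rr i ^ s) * μ (f i ⁻¹' A)) (hE : μ Eᶜ = 0)
    (fix : Fin N → EuclideanSpace ℝ (Fin n)) (hfix : ∀ i, f i (fix i) = fix i)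
    (hfixE : ∀ i, fix i ∈ E) (k : ℕ) :
    ∀ (x : EuclideanSpace ℝ (Fin n)) (d : ℝ),
      algMu f rr fix s (k + 1) (ball x d) ≤ μ (ball x (d + ρ ^ k)) ∧
      μ (ball x d) ≤ algMu f rr fix s (k + 1) (ball x (d + ρ ^ k)) := by
  have hfm : ∀ i, Measurable (f i) := by
    intro i
    have : LipschitzWith ⟨rr i, (hr i).1.le⟩ (f i) :=
      LipschitzWith.of_dist_le_mul fun x y => (hsim i x y).le
    exact this.continuous.measurable
  have hpre : ∀ i y d, f i ⁻¹' ball (f i y) d = ball y (d / rr i) := by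
    intro i y d
    ext z
    simp only [mem_preimage, mem_ball, hsim, lt_div_iff₀ (hr i).1, mul_comm]
  induction k with
  | zero =>
    intro x d
    rw [zero_add, algMu_one_apply f rr fix hfix s _ measurableSet_ball,
      algMu_one_apply f rr fix hfix s _ measurableSet_ball, hμss _ measurableSet_ball,
      hμss _ measurableSet_ball, pow_zero]
    have hlt : ∀ i, ∀ z ∈ E, dist (f i z) (fix i) < 1 := by
      intro i z hz
      conv_lhs => rw [← hfix i]
      rw [hsim]
      nlinarith [hEd z hz _ (hfixE i), (hr i).1, (hr i).2, dist_nonneg (x := z) (y := fix i)]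
    constructor
    · refine Finset.sum_le_sum fun i _ => mul_le_mul_right ?_ _
      by_cases h : fix i ∈ ball x d
      · have h1 : E ⊆ f i ⁻¹' ball x (d + 1) := by
          intro z hz
          rw [mem_preimage, mem_ball]
          rw [mem_ball] at h
          linarith [dist_triangle (f i z) (fix i) x, hlt i z hz]
        have h2 : μ (f i ⁻¹' ball x (d + 1))ᶜ = 0 :=
          measure_mono_null (compl_subset_compl.2 h1) hE
        rw [prob_compl_eq_zero_iff (hfm i measurableSet_ball)] at h2
        rw [h2]
        exact indicator_le_self' (by simp) _
      · simp [indicator_of_notMem h]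
    · refine Finset.sum_le_sum fun i _ => mul_le_mul_right ?_ _
      by_cases h : fix i ∈ ball x (d + 1)
      · rw [indicator_of_mem h]
        exact prob_le_one
      · have : f i ⁻¹' ball x d ⊆ Eᶜ := by
          intro z hz hzE
          apply h
          rw [mem_preimage, mem_ball] at hz
          rw [mem_ball]
          linarith [dist_triangle_left (fix i) x (f i z), hlt i z hzE]
        rw [measure_mono_null this hE]
        exact zero_le
  | succ k ih =>
    intro x d
    rw [algMu_succ_apply f hfm rr (fun i => (hr i).1) fix s k _ measurableSet_ball,
      algMu_succ_apply f hfm rr (fun i => (hr i).1) fix s k _ measurableSet_ball,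
      hμss _ measurableSet_ball, hμss _ measurableSet_ball]
    have hle : ∀ i, d / rr i + ρ ^ k ≤ (d + ρ ^ (k + 1)) / rr i := by
      intro i
      rw [le_div_iff₀ (hr i).1, add_mul, div_mul_cancel₀ _ (hr i).1.ne', pow_succ]
      have := mul_le_mul_of_nonneg_left (hρ i) (pow_nonneg hρ0.le k)
      linarith
    constructor
    · refine Finset.sum_le_sum fun i _ => mul_le_mul_right ?_ _
      obtain ⟨y, rfl⟩ := hsurj i x
      rw [hpre, hpre]
      exact (ih y _).1.trans (measure_mono (ball_subset_ball (hle i)))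
    · refine Finset.sum_le_sum fun i _ => mul_le_mul_right ?_ _
      obtain ⟨y, rfl⟩ := hsurj i x
      rw [hpre, hpre]
      exact (ih y _).2.trans (measure_mono (ball_subset_ball (hle i)))

theorem tendsto_ball_aux (μ : Measure (EuclideanSpace ℝ (Fin n))) [IsProbabilityMeasure μ]
    (hsph : ∀ x d, μ (sphere x d) = 0) (x : ℕ → EuclideanSpace ℝ (Fin n)) (d : ℕ → ℝ)
    (x₀ : EuclideanSpace ℝ (Fin n)) (d₀ : ℝ) (hx : Tendsto x atTop (𝓝 x₀))
    (hd : Tendsto d atTop (𝓝 d₀)) :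
    Tendsto (fun k => μ (ball (x k) (d k))) atTop (𝓝 (μ (closedBall x₀ d₀))) ∧
    Tendsto (fun k => μ (closedBall (x k) (d k))) atTop (𝓝 (μ (closedBall x₀ d₀))) := by
  have hae : ∀ᵐ y ∂μ, y ∉ sphere x₀ d₀ := measure_eq_zero_iff_ae_notMem.1 (hsph x₀ d₀)
  have hdist : ∀ y, Tendsto (fun k => dist y (x k)) atTop (𝓝 (dist y x₀)) :=
    fun y => tendsto_const_nhds.dist hx
  constructor
  · refine tendsto_measure_of_ae_tendsto_indicator_of_isFiniteMeasure _ measurableSet_closedBall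
        (fun k => measurableSet_ball) ?_
    filter_upwards [hae] with y hy
    rcases lt_or_gt_of_ne (show dist y x₀ ≠ d₀ from hy) with h | h
    · filter_upwards [(hdist y).eventually_lt hd h] with k hk
      simp [hk, h.le]
    · filter_upwards [hd.eventually_lt (hdist y) h] with k hk
      simp only [mem_ball, mem_closedBall, not_lt.2 hk.le, not_le.2 h]
  · refine tendsto_measure_of_ae_tendsto_indicator_of_isFiniteMeasure _ measurableSet_closedBall
        (fun k => measurableSet_closedBall) ?_
    filter_upwards [hae] with y hy
    rcases lt_or_gt_of_ne (show dist y x₀ ≠ d₀ from hy) with h | h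
    · filter_upwards [(hdist y).eventually_lt hd h] with k hk
      simp [hk.le, h.le]
    · filter_upwards [hd.eventually_lt (hdist y) h] with k hk
      simp only [mem_closedBall, not_le.2 hk, not_le.2 h]

end SelfSimilar

theorem discrete_density_converges_to_density_along_maximizers
{n N : ℕ} (hN : 2 ≤ N)
    (f : Fin N → EuclideanSpace ℝ (Fin n) → EuclideanSpace ℝ (Fin n))
    (rr : Fin N → ℝ) (hr : ∀ i, 0 < rr i ∧ rr i < 1)
    (hsim : ∀ i x y, dist (f i x) (f i y) = rr i * dist x y)
    (E : Set (EuclideanSpace ℝ (Fin n))) (hEne : E.Nonempty) (hEcp : IsCompact E)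
    (hEinv : E = ⋃ i, f i '' E)
    (hssc : ∀ i j, i ≠ j → Disjoint (f i '' E) (f j '' E))
(hEdiam : Metric.diam E = 1)
(rmin : ℝ) (hrmin : IsLeast (Set.range rr) rmin)
(c : ℝ) (hc : 0 < c)
    (hcdef : c = sInf {d : ℝ | ∃ i j : Fin N, i ≠ j ∧
      ∃ u ∈ f i '' E, ∃ v ∈ f j '' E, d = dist u v})
(s : ℝ) (hs : 0 < s) (hsum : ∑ i, rr i ^ s = 1)
    (μ : MeasureTheory.Measure (EuclideanSpace ℝ (Fin n))) (hμ : IsProbabilityMeasure μ)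
    (hμss : ∀ A : Set (EuclideanSpace ℝ (Fin n)), MeasurableSet A →
      μ A = ∑ i, ENNReal.ofReal (rr i ^ s) * μ (f i ⁻¹' A))
(fix : Fin N → EuclideanSpace ℝ (Fin n)) (hfix : ∀ i, f i (fix i) = fix i)
    (ct : ℝ) (hct : 0 < ct) (hct' : ct ≤ c)
    (xt : ℕ → EuclideanSpace ℝ (Fin n)) (dt : ℕ → ℝ)
    (hmem : ∀ k, 1 ≤ k → xt k ∈ algA f k ∧ dt k ∈ algD f ct rmin k)
    (hmax : ∀ k, 1 ≤ k → ∀ x ∈ algA f k, ∀ d ∈ algD f ct rmin k,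
      densityhk (algMu f rr fix s k) s x d ≤ densityhk (algMu f rr fix s k) s (xt k) (dt k)) :
    Filter.Tendsto (fun k =>
        |(densityhk (algMu f rr fix s k) s (xt k) (dt k)).toReal -
          (densityh μ s (xt k) (dt k)).toReal|)
      Filter.atTop (nhds 0) ∧
    ∀ φ : ℕ → ℕ, StrictMono φ → ∀ L : ℝ≥0∞,
      Filter.Tendsto (fun j => densityhk (algMu f rr fix s (φ j)) s (xt (φ j)) (dt (φ j)))
        Filter.atTop (nhds L) →
      Filter.Tendsto (fun j => densityh μ s (xt (φ j)) (dt (φ j))) Filter.atTop (nhds L) := by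


  have hN0 : 0 < N := by omega
  haveI : Nonempty (Fin N) := ⟨⟨0, hN0⟩⟩
  obtain ⟨i₁, hi₁⟩ := Finite.exists_max rr
  have hρ0 := (hr i₁).1
  have hρ1 := (hr i₁).2
  set ρ := rr i₁ with hρdef
  have hfE : ∀ i, ∀ x ∈ E, f i x ∈ E := by
    intro i x hx
    rw [hEinv]
    exact mem_iUnion.2 ⟨i, mem_image_of_mem _ hx⟩
  have hEd : ∀ x ∈ E, ∀ y ∈ E, dist x y ≤ 1 := by
    intro x hx y hy
    rw [← hEdiam]
    exact dist_le_diam_of_mem hEcp.isBounded hx hy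
  have hinj : ∀ i, Function.Injective (f i) := by
    intro i x y hxy
    have := hsim i x y
    rw [hxy, dist_self, eq_comm, mul_eq_zero] at this
    exact dist_eq_zero.1 (this.resolve_left (hr i).1.ne')
  have hsurj : ∀ i, Function.Surjective (f i) := fun i => sim_surjective (f i) _ (hr i).1 (hsim i)
  have hp : ∀ i, 0 < rr i ^ s := fun i => Real.rpow_pos_of_pos (hr i).1 s
  have hμr : ∀ A : Set (EuclideanSpace ℝ (Fin n)), MeasurableSet A →
      μ.real A = ∑ i, rr i ^ s * μ.real (f i ⁻¹' A) := by
    intro A hA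
    rw [measureReal_def, hμss A hA, ENNReal.toReal_sum]
    · refine Finset.sum_congr rfl fun i _ => ?_
      rw [ENNReal.toReal_mul, ENNReal.toReal_ofReal (hp i).le, measureReal_def]
    · intro i _
      exact ENNReal.mul_ne_top ENNReal.ofReal_ne_top (measure_ne_top _ _)
  have hE0 : μ Eᶜ = 0 := measure_compl_zero hN0 f rr ρ hρ1 hi₁ (fun i => (hr i).1) hsim E hEne hEcp
    hfE _ hp hsum μ hμr
  haveI : NullSingletonClass μ := noAtoms_aux f hinj E hEinv hssc _ hp (ρ ^ s)
    (fun i => Real.rpow_le_rpow (hr i).1.le (hi₁ i) hs.le) (Real.rpow_lt_one hρ0.le hρ1 hs)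
    (hp i₁) μ hμr hE0
  have hsph : ∀ x d, μ (sphere x d) = 0 := fun x d =>
    sphere_null_aux hN0 (fun i => Equiv.ofBijective (f i) ⟨hinj i, hsurj i⟩) rr hr hsim _ hp hsum μ
      hμr x d
  have hpos := ball_pos_aux hN0 f rr ρ hρ1 hi₁ (fun i => (hr i).1) hsim E hEinv hEd _ hp μ hμr hE0
  have hfx : ∀ i x, f i x = x → x ∈ E := fun i x hx =>
    fixed_mem (f i) (rr i) (hr i).2 (hsim i) E hEne hEcp (hfE i) x hx
  have hcmp := algMu_compare f hsurj rr ρ hρ0 hi₁ hr hsim E hEd s μ hμss hE0 fix hfix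
    (fun i => hfx i _ (hfix i))
  have core : ∀ ψ : ℕ → ℕ, Tendsto ψ atTop atTop → ∃ θ : ℕ → ℕ, StrictMono θ ∧ ∃ l : ℝ≥0∞, l ≠ ⊤ ∧
      Tendsto (fun j => densityhk (algMu f rr fix s (ψ (θ j))) s (xt (ψ (θ j))) (dt (ψ (θ j))))
        atTop (𝓝 l) ∧
      Tendsto (fun j => densityh μ s (xt (ψ (θ j))) (dt (ψ (θ j)))) atTop (𝓝 l) := by
    intro ψ hψ
    have hK : IsCompact (E ×ˢ Icc ct (ct / rmin)) := hEcp.prod isCompact_Icc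
    have hin : ∀ᶠ j in atTop, (xt (ψ j), dt (ψ j)) ∈ E ×ˢ Icc ct (ct / rmin) := by
      filter_upwards [hψ.eventually_ge_atTop 1] with j hj
      obtain ⟨h1, h2⟩ := hmem _ hj
      exact ⟨algA_subset f E hfE hfx _ h1, h2.2⟩
    obtain ⟨⟨x₀, d₀⟩, ⟨hx₀, hd₀⟩, θ, hθ, hlim⟩ := hK.tendsto_subseq' hin.frequently
    have hxl : Tendsto (fun j => xt (ψ (θ j))) atTop (𝓝 x₀) := (continuous_fst.tendsto _).comp hlim
    have hdl : Tendsto (fun j => dt (ψ (θ j))) atTop (𝓝 d₀) := (continuous_snd.tendsto _).comp hlim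
    have hd₀pos : 0 < d₀ := hct.trans_le hd₀.1
    have hm := hpos x₀ hx₀ d₀ hd₀pos
    have hψθ : Tendsto (fun j => ψ (θ j)) atTop atTop := hψ.comp hθ.tendsto_atTop
    have hε : Tendsto (fun j => ρ ^ (ψ (θ j) - 1)) atTop (𝓝 0) :=
      (tendsto_pow_atTop_nhds_zero_of_lt_one hρ0.le hρ1).comp
        ((tendsto_sub_atTop_nat 1).comp hψθ)
    have hup := (tendsto_ball_aux μ hsph _ (fun j => dt (ψ (θ j)) + ρ ^ (ψ (θ j) - 1)) x₀ d₀ hxl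
      (by simpa using hdl.add hε)).1
    have hlo := (tendsto_ball_aux μ hsph _ (fun j => dt (ψ (θ j)) - ρ ^ (ψ (θ j) - 1)) x₀ d₀ hxl
      (by simpa using hdl.sub hε)).1
    have hb := (tendsto_ball_aux μ hsph _ _ x₀ d₀ hxl hdl).2
    have ha : Tendsto (fun j => algMu f rr fix s (ψ (θ j)) (ball (xt (ψ (θ j))) (dt (ψ (θ j)))))
        atTop (𝓝 (μ (closedBall x₀ d₀))) := by
      refine tendsto_of_tendsto_of_tendsto_of_le_of_le' hlo hup ?_ ?_
      · filter_upwards [hψθ.eventually_ge_atTop 1] with j hj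
        obtain ⟨k, hk⟩ := Nat.exists_eq_add_of_le' hj
        have := (hcmp k (xt (ψ (θ j))) (dt (ψ (θ j)) - ρ ^ k)).2
        rw [sub_add_cancel, ← hk] at this
        simpa [hk] using this
      · filter_upwards [hψθ.eventually_ge_atTop 1] with j hj
        obtain ⟨k, hk⟩ := Nat.exists_eq_add_of_le' hj
        have := (hcmp k (xt (ψ (θ j))) (dt (ψ (θ j)))).1
        rw [← hk] at this
        simpa [hk] using this
    have hnum : Tendsto (fun j => ENNReal.ofReal ((2 * dt (ψ (θ j))) ^ s)) atTop
        (𝓝 (ENNReal.ofReal ((2 * d₀) ^ s))) :=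
      ENNReal.tendsto_ofReal ((hdl.const_mul 2).rpow_const (Or.inr hs.le))
    refine ⟨θ, hθ, ENNReal.ofReal ((2 * d₀) ^ s) / μ (closedBall x₀ d₀),
      ENNReal.div_ne_top ENNReal.ofReal_ne_top hm.ne', ?_, ?_⟩
    · exact ENNReal.Tendsto.div hnum (Or.inr hm.ne') ha (Or.inr ENNReal.ofReal_ne_top)
    · exact ENNReal.Tendsto.div hnum (Or.inr hm.ne') hb (Or.inr ENNReal.ofReal_ne_top)
  constructor
  · refine tendsto_of_subseq_tendsto fun ψ hψ => ?_
    obtain ⟨θ, hθ, l, hl, h1, h2⟩ := core ψ hψ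
    refine ⟨θ, ?_⟩
    have := (((ENNReal.tendsto_toReal hl).comp h1).sub ((ENNReal.tendsto_toReal hl).comp h2)).abs
    simpa using this
  · intro φ hφ L hL
    refine tendsto_of_subseq_tendsto fun ψ hψ => ?_
    obtain ⟨θ, hθ, l, hl, h1, h2⟩ := core (fun j => φ (ψ j)) (hφ.tendsto_atTop.comp hψ)
    refine ⟨θ, ?_⟩
    have h3 := hL.comp (hψ.comp hθ.tendsto_atTop)
    have : l = L := tendsto_nhds_unique h1 h3
    rw [← this]
    exact h2
end

section
/- Let x_0, y_0 ∈ E with x_0 ≠ y_0 and d_0 = dist(x_0, y_0). If (x_k), (y_k) are sequences with x_k, y_k ∈ A_k for all k ≥ 1, x_k → x_0 and y_k → y_0, then d_k := dist(x_k, y_k) → d_0 and (2d_k)^s / μ_k(B'(x_k, d_k)) → (2d_0)^s / μ(B(x_0, d_0)) as k → ∞. -/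
open Metric Set MeasureTheory Filter Topology
open scoped ENNReal NNReal

section helpers

variable {X : Type*} [MetricSpace X] [MeasurableSpace X] [BorelSpace X]

lemma aux_words {N : ℕ} (f : Fin N → X → X) (hf : ∀ i, Continuous (f i)) (rr : Fin N → ℝ)
    (hr : ∀ i, 0 < rr i) (s : ℝ) (μ : Measure X)
    (hμss : ∀ A : Set X, MeasurableSet A →
      μ A = ∑ i, ENNReal.ofReal (rr i ^ s) * μ (f i ⁻¹' A)) (k : ℕ) :
    ∀ A : Set X, MeasurableSet A → μ A = ∑ w : Fin k → Fin N,
      ENNReal.ofReal ((∏ j, rr (w j)) ^ s) * μ (wordComp f k w ⁻¹' A) := by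
  induction k with
  | zero => intro A hA; simp [wordComp]
  | succ k ih =>
    intro A hA
    rw [hμss A hA, ← (Fin.consEquiv (fun _ : Fin (k+1) => Fin N)).sum_comp, Fintype.sum_prod_type]
    refine Finset.sum_congr rfl fun i _ => ?_
    rw [ih _ ((hf i).measurable hA), Finset.mul_sum]
    refine Finset.sum_congr rfl fun w _ => ?_
    rw [Fin.prod_univ_succ, ← mul_assoc, ← ENNReal.ofReal_mul (by have := hr i; positivity),
      ← Real.mul_rpow (hr i).le (Finset.prod_nonneg fun j _ => (hr _).le)]
    rfl

lemma aux_word_dist {N : ℕ} (f : Fin N → X → X) (ρ : ℝ) (h0 : 0 ≤ ρ)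
    (hf : ∀ i x y, dist (f i x) (f i y) ≤ ρ * dist x y) (k : ℕ) :
    ∀ (w : Fin k → Fin N) x y, dist (wordComp f k w x) (wordComp f k w y) ≤ ρ ^ k * dist x y := by
  induction k with
  | zero => intro w x y; simp [wordComp]
  | succ k ih =>
    intro w x y
    calc _ ≤ ρ * _ := hf (w 0) _ _
      _ ≤ ρ * (ρ ^ k * dist x y) := by gcongr; exact ih _ _ _
      _ = _ := by ring

lemma aux_supp {N : ℕ} (f : Fin N → X → X) (hfc : ∀ i, Continuous (f i)) (ρ : ℝ) (h0 : 0 ≤ ρ)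
    (h1 : ρ < 1)
    (hf : ∀ i x y, dist (f i x) (f i y) ≤ ρ * dist x y) (p : Fin N → ℝ)
    (hp : ∀ i, 0 < p i) (hsum : ∑ i, p i = 1) (E : Set X) (hne : E.Nonempty) (hE : IsCompact E)
    (hinv : ∀ i, MapsTo (f i) E E)
    (μ : Measure X) [IsProbabilityMeasure μ]
    (hμss : ∀ A : Set X, MeasurableSet A → μ.real A = ∑ i, p i * μ.real (f i ⁻¹' A)) :
    μ Eᶜ = 0 := by
  have hmeas : ∀ t : ℝ, MeasurableSet {x | infDist x E ≤ t} := fun t =>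
    (isClosed_le (continuous_infDist_pt E) continuous_const).measurableSet
  have hstep : ∀ t : ℝ, μ.real {x | infDist x E ≤ t} ≤ μ.real {x | infDist x E ≤ ρ * t} := by
    intro t
    rw [hμss {x | infDist x E ≤ ρ * t} (hmeas _)]
    calc μ.real {x | infDist x E ≤ t} = ∑ i, p i * μ.real {x | infDist x E ≤ t} := by
          rw [← Finset.sum_mul, hsum, one_mul]
      _ ≤ _ := by
        refine Finset.sum_le_sum fun i _ => mul_le_mul_of_nonneg_left ?_ (hp i).le
        refine measureReal_mono ?_
        intro x hx
        obtain ⟨e, he, hxe⟩ := hE.exists_infDist_eq_dist hne x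
        show infDist (f i x) E ≤ ρ * t
        refine (infDist_le_dist_of_mem (hinv i he)).trans ((hf i x e).trans ?_)
        rw [← hxe]
        exact mul_le_mul_of_nonneg_left hx h0
  have hk : ∀ (k : ℕ) (t : ℝ), μ.real {x | infDist x E ≤ t} ≤ μ.real {x | infDist x E ≤ ρ ^ k * t} := by
    intro k t
    induction k with
    | zero => simp
    | succ k ih => exact ih.trans ((hstep _).trans (le_of_eq (by ring_nf)))
  have hEeq : E = ⋂ k : ℕ, {x | infDist x E ≤ 1 / ((k:ℝ) + 1)} := by
    ext x
    simp only [mem_iInter, mem_ofPred_eq]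
    constructor
    · intro hx k; rw [infDist_zero_of_mem hx]; positivity
    · intro h
      rw [hE.isClosed.mem_iff_infDist_zero hne]
      exact le_antisymm (ge_of_tendsto' tendsto_one_div_add_atTop_nhds_zero_nat h) infDist_nonneg
  have hbig : ∀ t : ℝ, μ {x | infDist x E ≤ t} ≤ μ E := by
    intro t
    have hlim : Tendsto (fun k : ℕ => μ {x | infDist x E ≤ 1 / ((k:ℝ) + 1)}) atTop (𝓝 (μ E)) := by
      conv_rhs => rw [hEeq]
      refine tendsto_measure_iInter_atTop (fun k => (hmeas _).nullMeasurableSet) ?_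
        ⟨0, measure_ne_top _ _⟩
      intro a b hab x hx
      have hx' : infDist x E ≤ 1 / ((b:ℝ) + 1) := hx
      have h3 : 1 / ((b:ℝ) + 1) ≤ 1 / ((a:ℝ) + 1) :=
        one_div_le_one_div_of_le (by positivity) (by gcongr)
      exact hx'.trans h3
    refine ge_of_tendsto' hlim fun m => ?_
    have : ∃ k : ℕ, ρ ^ k * t < 1 / ((m:ℝ) + 1) := by
      have : Tendsto (fun k : ℕ => ρ ^ k * t) atTop (𝓝 (0 * t)) :=
        (tendsto_pow_atTop_nhds_zero_of_lt_one h0 h1).mul_const t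
      rw [zero_mul] at this
      exact (this.eventually_lt_const (by positivity)).exists
    obtain ⟨k, hk'⟩ := this
    have h2 := hk k t
    rw [measureReal_def, measureReal_def,
      ENNReal.toReal_le_toReal (measure_ne_top _ _) (measure_ne_top _ _)] at h2
    exact h2.trans (measure_mono fun x hx => le_trans hx hk'.le)
  have huniv : μ univ ≤ μ E := by
    have hlim : Tendsto (fun k : ℕ => μ {x | infDist x E ≤ (k:ℝ)}) atTop
        (𝓝 (μ (⋃ k : ℕ, {x | infDist x E ≤ (k:ℝ)}))) :=
      tendsto_measure_iUnion_atTop fun a b hab x hx => by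
        have hx' : infDist x E ≤ (a:ℝ) := hx
        have h3 : (a:ℝ) ≤ b := by exact_mod_cast hab
        exact hx'.trans h3
    have : (⋃ k : ℕ, {x | infDist x E ≤ (k:ℝ)}) = univ := by
      ext x; simpa using exists_nat_ge (infDist x E)
    rw [this] at hlim
    exact le_of_tendsto' hlim fun k => hbig k
  rw [measure_compl hE.isClosed.measurableSet (measure_ne_top _ _)]
  exact tsub_eq_zero_of_le huniv

lemma aux_null {N : ℕ} (f : Fin N → X → X) (hfc : ∀ i, Continuous (f i)) (ρ : ℝ) (h0 : 0 ≤ ρ)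
    (h1 : ρ < 1)
    (hf : ∀ i x y, dist (f i x) (f i y) ≤ ρ * dist x y) (p : Fin N → ℝ)
    (hp : ∀ i, 0 < p i) (hsum : ∑ i, p i = 1) (E : Set X) (hE : IsCompact E)
    (hinv : E = ⋃ i, f i '' E)
    (μ : Measure X) [IsProbabilityMeasure μ]
    (hμss : ∀ A : Set X, MeasurableSet A → μ.real A = ∑ i, p i * μ.real (f i ⁻¹' A))
    (hsupp : μ Eᶜ = 0)
    {V : Type*} [NormedAddCommGroup V] [NormedSpace ℝ V] [FiniteDimensional ℝ V]
    (ev : V →ₗ[ℝ] X → ℝ) (hev : Continuous fun q : V × X => ev q.1 q.2)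
    (T : Fin N → V →ₗ[ℝ] V) (hT : ∀ i, Function.Injective (T i))
    (hTev : ∀ i v x, ev (T i v) x = ev v (f i x))
    (g : V) (z0 : X) (hz0 : z0 ∈ E) (hg : ev g z0 ≠ 0) : μ {x | ev g x = 0} = 0 := by
  have hmaps : ∀ i, MapsTo (f i) E E := by
    intro i x hx
    rw [hinv]; exact mem_iUnion.2 ⟨i, mem_image_of_mem _ hx⟩
  have hevx : ∀ v, Continuous (ev v) := fun v => hev.comp (by fun_prop : Continuous fun x => (v, x))
  have hclosed : ∀ v, IsClosed {x | ev v x = 0} := fun v => isClosed_eq (hevx v) continuous_const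
  have hS : ∀ v, μ {x | ev v x = 0} = μ (E ∩ {x | ev v x = 0}) := by
    intro v
    rw [inter_comm, measure_inter_conull hsupp]
  -- the kernel
  let K : Submodule ℝ V :=
    { carrier := {v | ∀ x ∈ E, ev v x = 0}
      add_mem' := by
        intro a b ha hb x hx
        simp [ha x hx, hb x hx]
      zero_mem' := by intro x _; simp
      smul_mem' := by
        intro c a ha x hx
        simp [ha x hx] }
  have hKmem : ∀ v, v ∈ K ↔ ∀ x ∈ E, ev v x = 0 := fun v => Iff.rfl
  have hTK : ∀ i v, T i v ∈ K → v ∈ K := by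
    intro i v hv
    have hle : K.map (T i) ≤ K := by
      rintro _ ⟨a, ha, rfl⟩ x hx
      rw [hTev]; exact ha _ (hmaps i hx)
    have heq : K.map (T i) = K :=
      Submodule.eq_of_le_of_finrank_eq hle ((Submodule.equivMapOfInjective (T i) (hT i) K).finrank_eq.symm)
    rw [← heq] at hv
    obtain ⟨a, ha, hav⟩ := hv
    rwa [← hT i hav]
  obtain ⟨W, hW⟩ := K.exists_isCompl
  let Sph : Set V := {v | v ∈ W ∧ ‖v‖ = 1}
  have hSphc : IsCompact Sph := by
    have : Sph = sphere (0:V) 1 ∩ W := by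
      ext v; simp [Sph, and_comm]
    rw [this]
    haveI : ProperSpace V := FiniteDimensional.proper ℝ V
    exact (isCompact_sphere 0 1).inter_right (Submodule.closed_of_finiteDimensional W)
  have hred : ∀ v, v ∉ K → ∃ u ∈ Sph, μ {x | ev v x = 0} = μ {x | ev u x = 0} := by
    intro v hv
    obtain ⟨a, ha, b, hb, rfl⟩ := Submodule.mem_sup.1 (hW.sup_eq_top ▸ Submodule.mem_top : v ∈ K ⊔ W)
    have hb0 : b ≠ 0 := by
      rintro rfl; exact hv (by simpa using ha)
    have hnb : ‖b‖ ≠ 0 := norm_ne_zero_iff.2 hb0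
    refine ⟨‖b‖⁻¹ • b, ⟨W.smul_mem _ hb, by rw [norm_smul, norm_inv, norm_norm, inv_mul_cancel₀ hnb]⟩, ?_⟩
    rw [hS, hS]
    congr 1
    ext x
    simp only [mem_inter_iff, mem_ofPred_eq]
    refine and_congr_right fun hx => ?_
    have := ha x hx
    simp [this, hnb]
  have hSphK : ∀ u ∈ Sph, u ∉ K := by
    intro u hu huK
    have : u ∈ K ⊓ W := ⟨huK, hu.1⟩
    rw [hW.inf_eq_bot, Submodule.mem_bot] at this
    have h := hu.2
    rw [this, norm_zero] at h
    exact zero_ne_one h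
  have hgK : g ∉ K := fun h => hg (h z0 hz0)
  obtain ⟨u0, hu0, -⟩ := hred g hgK
  have husc : UpperSemicontinuous fun v => μ {x | ev v x = 0} := by
    intro v y hy
    obtain ⟨U, hU, hUo, hUy⟩ := Set.exists_isOpen_lt_of_lt (E ∩ {x | ev v x = 0}) y (by rw [← hS]; exact hy)
    have hcomp : IsCompact (E \ U) := hE.diff hUo
    have : ∀ᶠ v' in 𝓝 v, ∀ x ∈ E \ U, ev v' x ≠ 0 := by
      refine hcomp.eventually_forall_of_forall_eventually ?_
      intro x hx
      have hne : ev v x ≠ 0 := fun h => hx.2 (hU ⟨hx.1, h⟩)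
      exact hev.continuousAt.eventually_ne hne
    filter_upwards [this] with v' hv'
    rw [hS]
    refine lt_of_le_of_lt (measure_mono ?_) hUy
    intro x hx
    by_contra hxU
    exact hv' x ⟨hx.1, hxU⟩ hx.2
  obtain ⟨m, hm, hmax⟩ := (husc.upperSemicontinuousOn Sph).exists_isMaxOn ⟨u0, hu0⟩ hSphc
  have hmax' : ∀ v, v ∉ K → μ.real {x | ev v x = 0} ≤ μ.real {x | ev m x = 0} := by
    intro v hv
    obtain ⟨u, hu, he⟩ := hred v hv
    rw [measureReal_def, he]
    exact ENNReal.toReal_mono (measure_ne_top _ _) (hmax hu)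
  set M := μ.real {x | ev m x = 0} with hM
  have hprop : ∀ i v, v ∉ K → μ.real {x | ev v x = 0} = M →
      T i v ∉ K ∧ μ.real {x | ev (T i v) x = 0} = M := by
    intro i v hv hvM
    refine ⟨fun h => hv (hTK i v h), ?_⟩
    have hTn : ∀ j, T j v ∉ K := fun j h => hv (hTK j v h)
    by_contra hne
    have hlt := lt_of_le_of_ne (hmax' _ (hTn i)) hne
    have h2 : μ.real {x | ev v x = 0} = ∑ j, p j * μ.real {x | ev (T j v) x = 0} := by
      rw [hμss _ (hclosed v).measurableSet]
      refine Finset.sum_congr rfl fun j _ => ?_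
      simp only [hTev]; rfl
    have h3 : ∑ j, p j * μ.real {x | ev (T j v) x = 0} < ∑ j, p j * M :=
      Finset.sum_lt_sum (fun j _ => mul_le_mul_of_nonneg_left (hmax' _ (hTn j)) (hp j).le)
        ⟨i, Finset.mem_univ _, mul_lt_mul_of_pos_left hlt (hp i)⟩
    rw [← h2, ← Finset.sum_mul, hsum, one_mul, hvM] at h3
    exact lt_irrefl _ h3
  have hzoom : ∀ k : ℕ, ∀ z ∈ E, ∃ h : X → X, (∃ z' ∈ E, h z' = z) ∧
      (∀ x y, dist (h x) (h y) ≤ ρ ^ k * dist x y) ∧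
      ∀ v, v ∉ K → μ.real {x | ev v x = 0} = M → μ.real {x | ev v (h x) = 0} = M := by
    intro k
    induction k with
    | zero =>
      intro z hz
      exact ⟨id, ⟨z, hz, rfl⟩, by simp, fun v _ h => h⟩
    | succ k ih =>
      intro z hz
      rw [hinv] at hz
      obtain ⟨i, z1, hz1, rfl⟩ := mem_iUnion.1 hz
      obtain ⟨h, ⟨z', hz', hhz⟩, hd, hv⟩ := ih z1 hz1
      refine ⟨f i ∘ h, ⟨z', hz', by simp [hhz]⟩, ?_, ?_⟩
      · intro x y
        calc _ ≤ ρ * dist (h x) (h y) := hf i _ _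
          _ ≤ ρ * (ρ ^ k * dist x y) := by gcongr; exact hd _ _
          _ = _ := by ring
      · intro v hvK hvM
        obtain ⟨ha, hb⟩ := hprop i v hvK hvM
        have := hv _ ha hb
        simpa only [hTev, Function.comp_apply] using this
  have hM0 : M = 0 := by
    have hmK := hSphK m hm
    rw [hKmem] at hmK
    push Not at hmK
    obtain ⟨z, hz, hmz⟩ := hmK
    obtain ⟨ε, hε, hball⟩ := Metric.eventually_nhds_iff.1 ((hevx m).continuousAt.eventually_ne hmz)
    have : Tendsto (fun k : ℕ => ρ ^ k * diam E) atTop (𝓝 (0 * diam E)) :=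
        (tendsto_pow_atTop_nhds_zero_of_lt_one h0 h1).mul_const _
    rw [zero_mul] at this
    obtain ⟨k, hk⟩ := (this.eventually_lt_const hε).exists
    obtain ⟨h, ⟨z', hz', hhz⟩, hd, hv⟩ := hzoom k z hz
    rw [← hv m (hSphK m hm) rfl, measureReal_eq_zero_iff]
    refine measure_mono_null ?_ hsupp
    intro x hx hxE
    refine hball (y := h x) ?_ hx
    rw [← hhz]
    refine lt_of_le_of_lt (hd _ _) (lt_of_le_of_lt ?_ hk)
    gcongr
    exact dist_le_diam_of_mem hE.isBounded hxE hz'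
  have := hmax' g hgK
  rw [hM0] at this
  exact (measureReal_eq_zero_iff (measure_ne_top _ _)).1 (le_antisymm this measureReal_nonneg)

end helpers

/-- the null-sphere statement -/
lemma aux_sphere {n N : ℕ}
    (f : Fin N → EuclideanSpace ℝ (Fin n) → EuclideanSpace ℝ (Fin n))
    (rr : Fin N → ℝ) (hr : ∀ i, 0 < rr i)
    (hsim : ∀ i x y, dist (f i x) (f i y) = rr i * dist x y)
    (ρ : ℝ) (h0 : 0 ≤ ρ) (h1 : ρ < 1) (hρ : ∀ i, rr i ≤ ρ)
    (E : Set (EuclideanSpace ℝ (Fin n))) (hEcp : IsCompact E)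
    (hEinv : E = ⋃ i, f i '' E)
    (p : Fin N → ℝ) (hp : ∀ i, 0 < p i) (hsum : ∑ i, p i = 1)
    (μ : Measure (EuclideanSpace ℝ (Fin n))) [IsProbabilityMeasure μ]
    (hμss : ∀ A : Set (EuclideanSpace ℝ (Fin n)), MeasurableSet A →
      μ.real A = ∑ i, p i * μ.real (f i ⁻¹' A))
    (hsupp : μ Eᶜ = 0) (x0 : EuclideanSpace ℝ (Fin n)) (hx0 : x0 ∈ E) (d : ℝ) (hd : 0 < d) :
    μ (sphere x0 d) = 0 := by
  have hfd : ∀ i x y, dist (f i x) (f i y) ≤ ρ * dist x y := fun i x y => by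
    rw [hsim]; gcongr; exact hρ i
  have hfc : ∀ i, Continuous (f i) := fun i =>
    (LipschitzWith.of_dist_le_mul (K := ⟨ρ, h0⟩) (hfd i)).continuous
  -- affine form
  have haff : ∀ i, ∃ L : EuclideanSpace ℝ (Fin n) ≃ₗᵢ[ℝ] EuclideanSpace ℝ (Fin n),
      ∀ x, f i x = rr i • L x + f i 0 := by
    intro i
    have hri := (hr i).ne'
    have hiso : Isometry fun x => (rr i)⁻¹ • f i x := by
      refine Isometry.of_dist_eq fun x y => ?_
      rw [dist_smul₀, hsim, Real.norm_of_nonneg (inv_nonneg.2 (hr i).le), inv_mul_cancel_left₀ hri]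
    let A := hiso.affineIsometryOfStrictConvexSpace
    refine ⟨A.linearIsometry.toLinearIsometryEquiv rfl, fun x => ?_⟩
    have h := A.map_vadd 0 x
    have hA : ∀ x, A x = (rr i)⁻¹ • f i x := fun x => rfl
    simp only [vadd_eq_add, add_zero, hA] at h
    have h' := congrArg (fun t => rr i • t) h
    simp only [smul_add, smul_inv_smul₀ hri] at h'
    exact h'
  choose L hL using haff
  let ev : (ℝ × EuclideanSpace ℝ (Fin n) × ℝ) →ₗ[ℝ] EuclideanSpace ℝ (Fin n) → ℝ :=
    { toFun := fun v x => v.1 * ‖x‖ ^ 2 + inner ℝ v.2.1 x + v.2.2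
      map_add' := by
        intro a b; ext x
        simp [inner_add_left]; ring
      map_smul' := by
        intro c a; ext x
        simp [real_inner_smul_left]; ring }
  let T : Fin N → (ℝ × EuclideanSpace ℝ (Fin n) × ℝ) →ₗ[ℝ] (ℝ × EuclideanSpace ℝ (Fin n) × ℝ) :=
    fun i =>
    { toFun := fun v => (v.1 * rr i ^ 2, rr i • (L i).symm (v.2.1 + (2 * v.1) • f i 0),
        v.2.2 + v.1 * ‖f i 0‖ ^ 2 + inner ℝ v.2.1 (f i 0))
      map_add' := by
        intro a b
        refine Prod.ext ?_ (Prod.ext ?_ ?_)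
        · simp; ring
        · simp only [Prod.fst_add, Prod.snd_add, ← smul_add, ← map_add]
          congr 2
          module
        · simp [inner_add_left]; ring
      map_smul' := by
        intro c a
        refine Prod.ext ?_ (Prod.ext ?_ ?_)
        · simp; ring
        · simp; module
        · simp [real_inner_smul_left]; ring }
  have hTapp : ∀ i v, T i v = (v.1 * rr i ^ 2, rr i • (L i).symm (v.2.1 + (2 * v.1) • f i 0),
        v.2.2 + v.1 * ‖f i 0‖ ^ 2 + inner ℝ v.2.1 (f i 0)) := fun _ _ => rfl
  have hevapp : ∀ v x, ev v x = v.1 * ‖x‖ ^ 2 + inner ℝ v.2.1 x + v.2.2 := fun _ _ => rfl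
  have hTinj : ∀ i, Function.Injective (T i) := by
    intro i
    rw [injective_iff_map_eq_zero]
    rintro ⟨a, v, c⟩ h
    have hri := (hr i).ne'
    simp only [hTapp, Prod.mk_eq_zero] at h
    obtain ⟨ha, hv, hc⟩ := h
    have ha' : a = 0 := by simpa [hri] using ha
    subst ha'
    have hv' : v = 0 := by simpa [hri] using hv
    subst hv'
    simpa using hc
  have hTev : ∀ i v x, ev (T i v) x = ev v (f i x) := by
    rintro i ⟨a, v, c⟩ x
    have e1 : ∀ u, inner ℝ ((L i).symm u) x = inner ℝ u (L i x) := by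
      intro u
      rw [← (L i).inner_map_map, LinearIsometryEquiv.apply_symm_apply]
    rw [hL i x, hevapp, hevapp, hTapp]
    simp only [norm_add_sq_real, real_inner_smul_left, real_inner_smul_right, inner_add_left,
      inner_add_right, e1, norm_smul, LinearIsometryEquiv.norm_map, mul_pow, Real.norm_eq_abs, sq_abs,
      real_inner_comm (L i x) (f i 0)]
    ring
  have hev : Continuous fun q : (ℝ × EuclideanSpace ℝ (Fin n) × ℝ) × EuclideanSpace ℝ (Fin n) =>
      ev q.1 q.2 := by
    simp only [hevapp]
    fun_prop
  have key : ∀ x, ev (1, (-2 : ℝ) • x0, ‖x0‖ ^ 2 - d ^ 2) x = dist x x0 ^ 2 - d ^ 2 := by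
    intro x
    rw [hevapp, dist_eq_norm, norm_sub_sq_real, real_inner_smul_left, real_inner_comm]
    ring
  have := aux_null f hfc ρ h0 h1 hfd p hp hsum E hEcp hEinv μ hμss hsupp ev hev T hTinj hTev
    (1, (-2 : ℝ) • x0, ‖x0‖ ^ 2 - d ^ 2) x0 hx0 (by rw [key]; simp [hd.ne'])
  refine measure_mono_null ?_ this
  intro x hx
  rw [mem_sphere] at hx
  show ev _ x = 0
  rw [key, hx, sub_self]

theorem discrete_density_converges_at_approximating_pairs
{n N : ℕ} (hN : 2 ≤ N)
    (f : Fin N → EuclideanSpace ℝ (Fin n) → EuclideanSpace ℝ (Fin n))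
    (rr : Fin N → ℝ) (hr : ∀ i, 0 < rr i ∧ rr i < 1)
    (hsim : ∀ i x y, dist (f i x) (f i y) = rr i * dist x y)
    (E : Set (EuclideanSpace ℝ (Fin n))) (hEne : E.Nonempty) (hEcp : IsCompact E)
    (hEinv : E = ⋃ i, f i '' E)
    (hssc : ∀ i j, i ≠ j → Disjoint (f i '' E) (f j '' E))
(hEdiam : Metric.diam E = 1)
(s : ℝ) (hs : 0 < s) (hsum : ∑ i, rr i ^ s = 1)
    (μ : MeasureTheory.Measure (EuclideanSpace ℝ (Fin n))) (hμ : IsProbabilityMeasure μ)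
    (hμss : ∀ A : Set (EuclideanSpace ℝ (Fin n)), MeasurableSet A →
      μ A = ∑ i, ENNReal.ofReal (rr i ^ s) * μ (f i ⁻¹' A))
    (fix : Fin N → EuclideanSpace ℝ (Fin n)) (hfix : ∀ i, f i (fix i) = fix i)
    (x0 y0 : EuclideanSpace ℝ (Fin n)) (hx0 : x0 ∈ E) (hy0 : y0 ∈ E) (hne : x0 ≠ y0)
    (xk yk : ℕ → EuclideanSpace ℝ (Fin n))
    (hxk : ∀ k, 1 ≤ k → xk k ∈ algA f k) (hyk : ∀ k, 1 ≤ k → yk k ∈ algA f k)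
    (hxlim : Filter.Tendsto xk Filter.atTop (nhds x0))
    (hylim : Filter.Tendsto yk Filter.atTop (nhds y0)) :
    Filter.Tendsto (fun k => dist (xk k) (yk k)) Filter.atTop (nhds (dist x0 y0)) ∧
    Filter.Tendsto (fun k => ENNReal.ofReal ((2 * dist (xk k) (yk k)) ^ s) /
        algMu f rr fix s k (Metric.ball (xk k) (dist (xk k) (yk k))))
      Filter.atTop
      (nhds (ENNReal.ofReal ((2 * dist x0 y0) ^ s) /
        μ (Metric.closedBall x0 (dist x0 y0)))) := by
  haveI : Nonempty (Fin N) := ⟨⟨0, by omega⟩⟩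
  obtain ⟨i0, hi0⟩ := Finite.exists_max rr
  set ρ := rr i0
  have h0 : 0 ≤ ρ := (hr i0).1.le
  have h1 : ρ < 1 := (hr i0).2
  have hfd : ∀ i x y, dist (f i x) (f i y) ≤ ρ * dist x y := fun i x y => by
    rw [hsim]; gcongr; exact hi0 i
  have hfc : ∀ i, Continuous (f i) := fun i =>
    (LipschitzWith.of_dist_le_mul (K := ⟨ρ, h0⟩) (hfd i)).continuous
  have hp : ∀ i, 0 < rr i ^ s := fun i => Real.rpow_pos_of_pos (hr i).1 s
  have hmaps : ∀ i, MapsTo (f i) E E := by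
    intro i x hx
    rw [hEinv]; exact mem_iUnion.2 ⟨i, mem_image_of_mem _ hx⟩
  have hreal : ∀ A : Set (EuclideanSpace ℝ (Fin n)), MeasurableSet A →
      μ.real A = ∑ i, rr i ^ s * μ.real (f i ⁻¹' A) := by
    intro A hA
    rw [measureReal_def, hμss A hA, ENNReal.toReal_sum
      (fun i _ => ENNReal.mul_ne_top ENNReal.ofReal_ne_top (measure_ne_top _ _))]
    refine Finset.sum_congr rfl fun i _ => ?_
    rw [ENNReal.toReal_mul, ENNReal.toReal_ofReal (hp i).le, measureReal_def]
  have hsupp : μ Eᶜ = 0 :=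
    aux_supp f hfc ρ h0 h1 hfd _ hp hsum E hEne hEcp hmaps μ hreal
  set d0 := dist x0 y0 with hd0
  have hd0pos : 0 < d0 := dist_pos.2 hne
  have hsph : μ (sphere x0 d0) = 0 :=
    aux_sphere f rr (fun i => (hr i).1) hsim ρ h0 h1 hi0 E hEcp hEinv _ hp hsum μ hreal hsupp
      x0 hx0 d0 hd0pos
  have hdlim : Tendsto (fun k => dist (xk k) (yk k)) atTop (𝓝 d0) := hxlim.dist hylim
  refine ⟨hdlim, ?_⟩
  -- a bound for the distance from points of `E` to fixed points
  obtain ⟨D, hD⟩ : ∃ D : ℝ, ∀ i, ∀ x ∈ E, dist x (fix i) ≤ D := by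
    have hb : Bornology.IsBounded (E ∪ range fix) := hEcp.isBounded.union (finite_range fix).isBounded
    exact ⟨diam (E ∪ range fix), fun i x hx =>
      dist_le_diam_of_mem hb (Or.inl hx) (Or.inr (mem_range_self i))⟩
  let ε : ℕ → ℝ := fun k => |dist (xk k) (yk k) - d0| + dist (xk k) x0 + ρ ^ k * D
  have hεlim : Tendsto ε atTop (𝓝 0) := by
    have a1 : Tendsto (fun k => |dist (xk k) (yk k) - d0|) atTop (𝓝 0) := by
      simpa using (hdlim.sub_const d0).abs
    have a2 : Tendsto (fun k => dist (xk k) x0) atTop (𝓝 0) := tendsto_iff_dist_tendsto_zero.1 hxlim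
    have a3 : Tendsto (fun k : ℕ => ρ ^ k * D) atTop (𝓝 0) := by
      simpa using (tendsto_pow_atTop_nhds_zero_of_lt_one h0 h1).mul_const D
    simpa using (a1.add a2).add a3
  have hpt : ∀ (k : ℕ) (w : Fin (k+1) → Fin N), ∀ x ∈ E,
      dist (wordComp f (k+1) w x) (wordComp f (k+1) w (fix (w (Fin.last k)))) ≤ ρ ^ (k+1) * D := by
    intro k w x hx
    refine (aux_word_dist f ρ h0 hfd (k+1) w _ _).trans ?_
    gcongr
    exact hD _ _ hx
  have hwords := fun k => aux_words f hfc rr (fun i => (hr i).1) s μ hμss k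
  have hμk : ∀ (k : ℕ) (A : Set (EuclideanSpace ℝ (Fin n))), MeasurableSet A →
      algMu f rr fix s (k+1) A = ∑ w : Fin (k+1) → Fin N, ENNReal.ofReal ((∏ j, rr (w j)) ^ s) *
        A.indicator 1 (wordComp f (k+1) w (fix (w (Fin.last k)))) := by
    intro k A hA
    simp [algMu, Measure.dirac_apply' _ hA]
  have hEone : ∀ A : Set (EuclideanSpace ℝ (Fin n)), E ⊆ A → 1 ≤ μ A := by
    intro A hA
    have : μ Aᶜ = 0 := measure_mono_null (compl_subset_compl.2 hA) hsupp
    have h2 := measure_univ_le_add_compl (μ := μ) A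
    simpa [this] using h2
  have hup : ∀ k, 1 ≤ k → algMu f rr fix s k (ball (xk k) (dist (xk k) (yk k))) ≤
      μ (closedBall x0 (d0 + ε k)) := by
    rintro (_ | k) hk
    · omega
    rw [hμk _ _ measurableSet_ball, hwords (k+1) _ measurableSet_closedBall]
    refine Finset.sum_le_sum fun w _ => mul_le_mul_right ?_ _
    by_cases hm : wordComp f (k+1) w (fix (w (Fin.last k))) ∈
        ball (xk (k+1)) (dist (xk (k+1)) (yk (k+1)))
    · rw [indicator_of_mem hm]
      refine hEone _ fun x hx => ?_
      have b1 := hpt k w x hx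
      rw [mem_ball] at hm
      show wordComp f (k+1) w x ∈ closedBall x0 (d0 + ε (k+1))
      rw [mem_closedBall]
      have b2 := dist_triangle4 (wordComp f (k+1) w x)
        (wordComp f (k+1) w (fix (w (Fin.last k)))) (xk (k+1)) x0
      have b3 := le_abs_self (dist (xk (k+1)) (yk (k+1)) - d0)
      simp only [ε]
      linarith
    · rw [indicator_of_notMem hm]; exact zero_le
  have hlow : ∀ k, 1 ≤ k → μ (ball x0 (d0 - ε k)) ≤
      algMu f rr fix s k (ball (xk k) (dist (xk k) (yk k))) := by
    rintro (_ | k) hk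
    · omega
    rw [hμk _ _ measurableSet_ball, hwords (k+1) _ measurableSet_ball]
    refine Finset.sum_le_sum fun w _ => mul_le_mul_right ?_ _
    by_cases hm : wordComp f (k+1) w (fix (w (Fin.last k))) ∈
        ball (xk (k+1)) (dist (xk (k+1)) (yk (k+1)))
    · rw [indicator_of_mem hm]; exact prob_le_one
    · rw [indicator_of_notMem hm]
      refine le_of_eq (measure_mono_null ?_ hsupp)
      intro x hx hxE
      refine hm ?_
      have b1 := hpt k w x hxE
      have hx' : dist (wordComp f (k+1) w x) x0 < d0 - ε (k+1) := hx
      rw [mem_ball]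
      have b2 := dist_triangle4 (wordComp f (k+1) w (fix (w (Fin.last k))))
        (wordComp f (k+1) w x) x0 (xk (k+1))
      have b3 := neg_abs_le (dist (xk (k+1)) (yk (k+1)) - d0)
      rw [dist_comm (wordComp f (k+1) w (fix (w (Fin.last k)))) (wordComp f (k+1) w x), dist_comm x0] at b2
      simp only [ε] at hx'
      linarith
  have hballeq : μ (ball x0 d0) = μ (closedBall x0 d0) := by
    refine le_antisymm (measure_mono ball_subset_closedBall) ?_
    rw [← ball_union_sphere]
    refine (measure_union_le _ _).trans (by rw [hsph, add_zero])
  have hclim : Tendsto (fun k => algMu f rr fix s k (ball (xk k) (dist (xk k) (yk k)))) atTop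
      (𝓝 (μ (closedBall x0 d0))) := by
    rw [tendsto_order]
    constructor
    · intro a ha
      rw [← hballeq] at ha
      have hu : Tendsto (fun m : ℕ => μ (ball x0 (d0 - 1 / ((m:ℝ) + 1)))) atTop
          (𝓝 (μ (⋃ m : ℕ, ball x0 (d0 - 1 / ((m:ℝ) + 1))))) := by
        refine tendsto_measure_iUnion_atTop fun a b hab => ball_subset_ball ?_
        have : 1 / ((b:ℝ) + 1) ≤ 1 / ((a:ℝ) + 1) :=
          one_div_le_one_div_of_le (by positivity) (by gcongr)
        linarith
      have heq : (⋃ m : ℕ, ball x0 (d0 - 1 / ((m:ℝ) + 1))) = ball x0 d0 := by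
        ext x
        simp only [mem_iUnion, mem_ball]
        constructor
        · rintro ⟨m, hm⟩
          have : 0 < 1 / ((m:ℝ) + 1) := by positivity
          linarith
        · intro hx
          obtain ⟨m, hm⟩ := exists_nat_one_div_lt (sub_pos.2 hx)
          exact ⟨m, by linarith⟩
      rw [heq] at hu
      obtain ⟨m, hm⟩ := (hu.eventually_const_lt ha).exists
      filter_upwards [hεlim.eventually_lt_const (show (0:ℝ) < 1 / ((m:ℝ) + 1) by positivity),
        eventually_ge_atTop 1] with k hk hk1
      exact hm.trans_le ((measure_mono (ball_subset_ball (by linarith))).trans (hlow k hk1))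
    · intro a ha
      have hu : Tendsto (fun m : ℕ => μ (closedBall x0 (d0 + 1 / ((m:ℝ) + 1)))) atTop
          (𝓝 (μ (⋂ m : ℕ, closedBall x0 (d0 + 1 / ((m:ℝ) + 1))))) := by
        refine tendsto_measure_iInter_atTop
          (fun m => measurableSet_closedBall.nullMeasurableSet) (fun a b hab => ?_)
          ⟨0, measure_ne_top _ _⟩
        refine closedBall_subset_closedBall ?_
        have : 1 / ((b:ℝ) + 1) ≤ 1 / ((a:ℝ) + 1) :=
          one_div_le_one_div_of_le (by positivity) (by gcongr)
        linarith
      have heq : (⋂ m : ℕ, closedBall x0 (d0 + 1 / ((m:ℝ) + 1))) = closedBall x0 d0 := by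
        ext x
        simp only [mem_iInter, mem_closedBall]
        constructor
        · intro h
          by_contra hx
          obtain ⟨m, hm⟩ := exists_nat_one_div_lt (sub_pos.2 (not_le.1 hx))
          have := h m
          linarith
        · intro hx m
          have : 0 < 1 / ((m:ℝ) + 1) := by positivity
          linarith
      rw [heq] at hu
      obtain ⟨m, hm⟩ := (hu.eventually_lt_const ha).exists
      filter_upwards [hεlim.eventually_lt_const (show (0:ℝ) < 1 / ((m:ℝ) + 1) by positivity),
        eventually_ge_atTop 1] with k hk hk1
      exact lt_of_le_of_lt ((hup k hk1).trans
        (measure_mono (closedBall_subset_closedBall (by linarith)))) hm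
  have hnum : Tendsto (fun k => ENNReal.ofReal ((2 * dist (xk k) (yk k)) ^ s)) atTop
      (𝓝 (ENNReal.ofReal ((2 * d0) ^ s))) :=
    ENNReal.tendsto_ofReal ((hdlim.const_mul 2).rpow_const (Or.inr hs.le))
  refine ENNReal.Tendsto.div hnum (Or.inl ?_) hclim (Or.inr ENNReal.ofReal_ne_top)
  have : 0 < (2 * d0) ^ s := by positivity
  simpa using this
end
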